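/- Under Assumption 2.3 (with z_{v₀,e₀} and z_{v₁,e₀} finite), one has E_{ℚ_{v₀,e₀}}[ (x_{v₁}/x_{v₀})^{1/4} ] ≤ exp( −1/(32·S_φ) ), where S_φ := ∑_{v∈V} ((a_v+1)/2) · max_{e,e'∈E: v∈e, v∈e'} (φ(e) − φ(e'))². -/

import Mathlib

open MeasureTheory
open scoped ENNReal Classical

namespace ERRWGraph

noncomputable section

variable {V : Type*} [Fintype V] [DecidableEq V]

/-- The measure `dx/x` on `(0,∞)`, i.e. Lebesgue measure on a logarithmic scale. -/
def logMeasure : Measure ℝ :=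
  (volume.restrict (Set.Ioi (0 : ℝ))).withDensity fun x => ENNReal.ofReal (1 / x)

variable (G : SimpleGraph V) [Fintype G.edgeSet]

/-- The set `Ω_{e₀}` of strictly positive edge weights normalized at the reference
edge `e₀`. -/
def Omega (e₀ : G.edgeSet) : Set (G.edgeSet → ℝ) :=
  {x | (∀ e, 0 < x e) ∧ x e₀ = 1}

/-- The reference measure `ρ_{e₀} = δ₁(dx_{e₀}) ∏_{e ≠ e₀} dx_e/x_e`, realized as a
measure on `(0,∞)^E ⊆ ℝ^E` concentrated on `Ω_{e₀}`. -/
def rho (e₀ : G.edgeSet) : Measure (G.edgeSet → ℝ) :=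
  Measure.pi fun e => if e = e₀ then Measure.dirac 1 else logMeasure

/-- Vertex weight `x_v = ∑_{e ∋ v} x_e`. -/
def vwt (x : G.edgeSet → ℝ) (v : V) : ℝ :=
  ∑ e : G.edgeSet, if v ∈ (e : Sym2 V) then x e else 0

/-- Vertex weight `a_v = ∑_{e ∋ v} a_e` of the initial weights `a : Sym2 V → ℝ`. -/
def avwt (a : Sym2 V → ℝ) (v : V) : ℝ :=
  ∑ e : G.edgeSet, if v ∈ (e : Sym2 V) then a (e : Sym2 V) else 0

/-- A set `T` of edges of `G` is a spanning tree iff the graph with edge set `T`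
is a tree (i.e. a maximal connected acyclic subgraph of `G`). -/
def IsSpanningTree (T : Finset G.edgeSet) : Prop :=
  (SimpleGraph.fromEdgeSet (Subtype.val '' (T : Set G.edgeSet))).IsTree

/-- `∑_{T ∈ 𝒯} ∏_{e ∈ T} x_e`, the sum over spanning trees of `G`. -/
def treeSum (x : G.edgeSet → ℝ) : ℝ :=
  ∑ T : Finset G.edgeSet, if IsSpanningTree G T then (∏ e ∈ T, x e) else 0

/-- The function `Φ_{v₀,a}` from the Coppersmith–Diaconis description of the
mixing measure. -/
def Phi (a : Sym2 V → ℝ) (v₀ : V) (x : G.edgeSet → ℝ) : ℝ :=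
  (∏ e : G.edgeSet, x e ^ a (e : Sym2 V)) * vwt G x v₀ ^ (-avwt G a v₀ / 2) *
    (∏ v ∈ Finset.univ.erase v₀, vwt G x v ^ (-(avwt G a v + 1) / 2)) *
    Real.sqrt (treeSum G x)

/-- The normalizing constant `z_{v₀,e₀} = ∫ Φ_{v₀,a} dρ_{e₀}`. -/
def z (a : Sym2 V → ℝ) (v₀ : V) (e₀ : G.edgeSet) : ℝ≥0∞ :=
  ∫⁻ x, ENNReal.ofReal (Phi G a v₀ x) ∂rho G e₀

/-- The mixing measure `ℚ_{v₀,e₀}`, with density `Φ_{v₀,a}/z_{v₀,e₀}` w.r.t. `ρ_{e₀}`. -/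
def Qm (a : Sym2 V → ℝ) (v₀ : V) (e₀ : G.edgeSet) : Measure (G.edgeSet → ℝ) :=
  (z G a v₀ e₀)⁻¹ • (rho G e₀).withDensity fun x => ENNReal.ofReal (Phi G a v₀ x)

/-- The density `((Φ_{v₀,a}/z_{v₀,e₀})·(Φ_{v₁,a}/z_{v₁,e₀}))^{1/2}` of the
interpolated measure. -/
def interpDens (a : Sym2 V → ℝ) (v₀ v₁ : V) (e₀ : G.edgeSet) (x : G.edgeSet → ℝ) : ℝ≥0∞ :=
  (ENNReal.ofReal (Phi G a v₀ x) / z G a v₀ e₀ *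
    (ENNReal.ofReal (Phi G a v₁ x) / z G a v₁ e₀)) ^ (1 / 2 : ℝ)

/-- The normalizing constant `Z_{v₀,v₁,e₀}` of the interpolated measure. -/
def Zc (a : Sym2 V → ℝ) (v₀ v₁ : V) (e₀ : G.edgeSet) : ℝ≥0∞ :=
  ∫⁻ x, interpDens G a v₀ v₁ e₀ x ∂rho G e₀

/-- The interpolated measure `ℙ_{v₀,v₁,e₀}`. -/
def Pm (a : Sym2 V → ℝ) (v₀ v₁ : V) (e₀ : G.edgeSet) : Measure (G.edgeSet → ℝ) :=
  (Zc G a v₀ v₁ e₀)⁻¹ • (rho G e₀).withDensity (interpDens G a v₀ v₁ e₀)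

/-- `f` is an automorphism of the weighted graph `(G,a)`. -/
def IsAut (a : Sym2 V → ℝ) (f : V → V) : Prop :=
  Function.Bijective f ∧ (∀ u v : V, G.Adj (f u) (f v) ↔ G.Adj u v) ∧
    ∀ u v : V, G.Adj u v → a s(f u, f v) = a s(u, v)

/-- Assumption 2.3 of the paper. -/
def Assumption23 (a φ : Sym2 V → ℝ) (v₀ v₁ : V) (e₀ : G.edgeSet) : Prop :=
  v₀ ≠ v₁ ∧ ¬G.Adj v₀ v₁ ∧ v₀ ∈ (e₀ : Sym2 V) ∧
    (∃ f : V → V, IsAut G a f ∧ f v₀ = v₁ ∧ f v₁ = v₀) ∧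
    (∀ e : G.edgeSet, φ (e : Sym2 V) ∈ Set.Icc (0 : ℝ) 1) ∧
    (∀ e : G.edgeSet, v₀ ∈ (e : Sym2 V) → φ (e : Sym2 V) = 0) ∧
    (∀ e : G.edgeSet, v₁ ∈ (e : Sym2 V) → φ (e : Sym2 V) = 1)

/-- `max_{e,e' ∋ v} (φ(e) - φ(e'))²`. -/
def maxsq (φ : Sym2 V → ℝ) (v : V) : ℝ :=
  sSup ((fun p : G.edgeSet × G.edgeSet =>
      (φ (p.1 : Sym2 V) - φ (p.2 : Sym2 V)) ^ 2) ''
    {p : G.edgeSet × G.edgeSet | v ∈ (p.1 : Sym2 V) ∧ v ∈ (p.2 : Sym2 V)})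

/-- The "Dirichlet form" `S_φ`. -/
def Sphi (a φ : Sym2 V → ℝ) : ℝ :=
  ∑ v : V, (avwt G a v + 1) / 2 * maxsq G φ v

/-- `H_{v₀,v₁}(x) = (1/4) log (x_{v₁}/x_{v₀})`. -/
def Hfun (v₀ v₁ : V) (x : G.edgeSet → ℝ) : ℝ :=
  (1 / 4) * Real.log (vwt G x v₁ / vwt G x v₀)

/-- `log (dQ/dP)` realized via the Radon–Nikodym derivative. -/
def logRN {α : Type*} [MeasurableSpace α] (Q P : Measure α) (x : α) : ℝ :=
  Real.log ((Q.rnDeriv P x).toReal)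

/-- The deformation map `Ξ^{γφ}(x) = (e^{γφ(e)} x_e)_{e∈E}`. -/
def Xi (φ : Sym2 V → ℝ) (γ : ℝ) (x : G.edgeSet → ℝ) : G.edgeSet → ℝ :=
  fun e => Real.exp (γ * φ (e : Sym2 V)) * x e

/-- `Π^{γφ}`, the image of `ℙ_{v₀,v₁,e₀}` under `Ξ^{γφ}`. -/
def PiGamma (a φ : Sym2 V → ℝ) (v₀ v₁ : V) (e₀ : G.edgeSet) (γ : ℝ) :
    Measure (G.edgeSet → ℝ) :=
  Measure.map (Xi G φ γ) (Pm G a v₀ v₁ e₀)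

/-- The explicit realization `f_γ` of `log(dΠ^{γφ}/dℙ_{v₀,v₁,e₀}) ∘ Ξ^{γφ}`. -/
def fgamma (a φ : Sym2 V → ℝ) (v₀ v₁ : V) (γ : ℝ) (x : G.edgeSet → ℝ) : ℝ :=
  γ * (avwt G a v₁ / 2 + 1 / 4) -
    γ * ∑ e : G.edgeSet, φ (e : Sym2 V) * a (e : Sym2 V) +
    (∑ v ∈ Finset.univ \ {v₀, v₁}, (avwt G a v + 1) / 2 *
      Real.log (vwt G (Xi G φ γ x) v / vwt G x v)) -
    (1 / 2) * Real.log (treeSum G (Xi G φ γ x) / treeSum G x)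

/-- Mean of `φ` under the measure `μ_{x,v,γ}` on the edges incident to `v`. -/
def muMean (φ : Sym2 V → ℝ) (γ : ℝ) (x : G.edgeSet → ℝ) (v : V) : ℝ :=
  (∑ e : G.edgeSet, if v ∈ (e : Sym2 V) then φ (e : Sym2 V) * Xi G φ γ x e else 0) /
    vwt G (Xi G φ γ x) v

/-- Variance of `φ` under `μ_{x,v,γ}`. -/
def muVar (φ : Sym2 V → ℝ) (γ : ℝ) (x : G.edgeSet → ℝ) (v : V) : ℝ :=
  (∑ e : G.edgeSet, if v ∈ (e : Sym2 V) then
      (φ (e : Sym2 V) - muMean G φ γ x v) ^ 2 * Xi G φ γ x e else 0) /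
    vwt G (Xi G φ γ x) v

/-- `Δ(T) = ∑_{e ∈ T} φ(e)`. -/
def Delta (φ : Sym2 V → ℝ) (T : Finset G.edgeSet) : ℝ := ∑ e ∈ T, φ (e : Sym2 V)

/-- Mean of `Δ` under the measure `ν_{x,γ}` on spanning trees. -/
def nuMean (φ : Sym2 V → ℝ) (γ : ℝ) (x : G.edgeSet → ℝ) : ℝ :=
  (∑ T : Finset G.edgeSet, if IsSpanningTree G T then
      Delta G φ T * ∏ e ∈ T, Xi G φ γ x e else 0) /
    treeSum G (Xi G φ γ x)

/-- Variance of `Δ` under `ν_{x,γ}`. -/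
def nuVar (φ : Sym2 V → ℝ) (γ : ℝ) (x : G.edgeSet → ℝ) : ℝ :=
  (∑ T : Finset G.edgeSet, if IsSpanningTree G T then
      (Delta G φ T - nuMean G φ γ x) ^ 2 * ∏ e ∈ T, Xi G φ γ x e else 0) /
    treeSum G (Xi G φ γ x)

/-- The claimed first derivative of `γ ↦ f_γ(x)`. -/
def fder1 (a φ : Sym2 V → ℝ) (v₀ v₁ : V) (x : G.edgeSet → ℝ) (γ : ℝ) : ℝ :=
  avwt G a v₁ / 2 + 1 / 4 - (∑ e : G.edgeSet, φ (e : Sym2 V) * a (e : Sym2 V)) +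
    (∑ v ∈ Finset.univ \ {v₀, v₁}, (avwt G a v + 1) / 2 * muMean G φ γ x v) -
    (1 / 2) * nuMean G φ γ x

/-- The claimed second derivative of `γ ↦ f_γ(x)`. -/
def fder2 (a φ : Sym2 V → ℝ) (v₀ v₁ : V) (x : G.edgeSet → ℝ) (γ : ℝ) : ℝ :=
  (∑ v ∈ Finset.univ \ {v₀, v₁}, (avwt G a v + 1) / 2 * muVar G φ γ x v) -
    (1 / 2) * nuVar G φ γ x

/-- Membership in the class `𝒫` of the variational principle. -/
def VarP (a : Sym2 V → ℝ) (v₀ v₁ : V) (e₀ : G.edgeSet)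
    (Q : Measure (G.edgeSet → ℝ)) : Prop :=
  IsProbabilityMeasure Q ∧ Q ≪ Pm G a v₀ v₁ e₀ ∧ Pm G a v₀ v₁ e₀ ≪ Q ∧
    Integrable (Hfun G v₀ v₁) Q ∧ Integrable (logRN Q (Pm G a v₀ v₁ e₀)) Q

/-- The functional `F(Π) = E_Π[H] + E_Π[log(dΠ/dℙ_{v₀,v₁,e₀})]`. -/
def Ffun (a : Sym2 V → ℝ) (v₀ v₁ : V) (e₀ : G.edgeSet)
    (Q : Measure (G.edgeSet → ℝ)) : ℝ :=
  (∫ x, Hfun G v₀ v₁ x ∂Q) + ∫ x, logRN Q (Pm G a v₀ v₁ e₀) x ∂Q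

end

end ERRWGraph

namespace ERRWGraph

set_option linter.unusedSectionVars false

section Algebra

variable {V : Type*} [Fintype V] [DecidableEq V] (G : SimpleGraph V) [Fintype G.edgeSet]

lemma exists_edge_mem [Nontrivial V] (hG : G.Connected) (v : V) :
    ∃ e : G.edgeSet, v ∈ (e : Sym2 V) := by
  obtain ⟨w, hw⟩ := hG.preconnected.exists_adj_of_nontrivial v
  exact ⟨⟨s(v, w), hw⟩, Sym2.mem_mk_left v w⟩

lemma vwt_pos [Nontrivial V] (hG : G.Connected) {x : G.edgeSet → ℝ} (hx : ∀ e, 0 < x e) (v : V) :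
    0 < vwt G x v := by
  obtain ⟨e, he⟩ := exists_edge_mem G hG v
  refine Finset.sum_pos' (fun e _ => ?_) ⟨e, Finset.mem_univ e, ?_⟩
  · split_ifs
    exacts [(hx e).le, le_rfl]
  · rw [if_pos he]
    exact hx e

lemma avwt_nonneg {a : Sym2 V → ℝ} (ha : ∀ e ∈ G.edgeSet, 0 < a e) (v : V) : 0 ≤ avwt G a v :=
  Finset.sum_nonneg fun e _ => by
    split_ifs
    exacts [(ha e e.2).le, le_rfl]

lemma exists_isSpanningTree (hG : G.Connected) : ∃ T : Finset G.edgeSet, IsSpanningTree G T := by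
  obtain ⟨T, hT, hT'⟩ := hG.exists_isTree_le
  refine ⟨Finset.univ.filter fun e => (e : Sym2 V) ∈ T.edgeSet, ?_⟩
  have : (Subtype.val '' ((Finset.univ.filter fun e : G.edgeSet => (e : Sym2 V) ∈ T.edgeSet :
      Finset G.edgeSet) : Set G.edgeSet)) = T.edgeSet := by
    ext e
    simp only [Finset.coe_filter, Finset.mem_univ, true_and, Set.mem_image, Set.mem_ofPred_eq,
      Subtype.exists, exists_and_left, exists_prop, exists_eq_right_right, and_iff_left_iff_imp]
    exact fun he => SimpleGraph.edgeSet_mono hT he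
  rw [IsSpanningTree, this, SimpleGraph.fromEdgeSet_edgeSet]
  exact hT'

lemma IsSpanningTree.card {T : Finset G.edgeSet} (hT : IsSpanningTree G T) :
    T.card + 1 = Fintype.card V := by
  rw [← hT.card_edgeFinset, ← Finset.card_image_of_injective T Subtype.val_injective]
  congr 2
  ext e
  simp only [SimpleGraph.mem_edgeFinset, SimpleGraph.edgeSet_fromEdgeSet, Set.mem_sdiff,
    Finset.mem_image, Set.mem_image, Finset.mem_coe]
  refine ⟨fun h => ⟨h, ?_⟩, fun h => h.1⟩
  obtain ⟨e, -, rfl⟩ := h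
  exact G.not_isDiag_of_mem_edgeSet e.2

lemma treeSum_pos (hG : G.Connected) {x : G.edgeSet → ℝ} (hx : ∀ e, 0 < x e) :
    0 < treeSum G x := by
  obtain ⟨T, hT⟩ := exists_isSpanningTree G hG
  refine Finset.sum_pos' (fun T _ => ?_) ⟨T, Finset.mem_univ T, ?_⟩
  · split_ifs
    exacts [Finset.prod_nonneg fun e _ => (hx e).le, le_rfl]
  · rw [if_pos hT]
    exact Finset.prod_pos fun e _ => hx e

/-- A form of `Phi` in which the distinguished vertex enters only through one square root. -/
lemma Phi_eq [Nontrivial V] (hG : G.Connected) (a : Sym2 V → ℝ) (v₀ : V) {x : G.edgeSet → ℝ}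
    (hx : ∀ e, 0 < x e) :
    Phi G a v₀ x = (∏ e : G.edgeSet, x e ^ a (e : Sym2 V)) *
      (∏ v, vwt G x v ^ (-(avwt G a v + 1) / 2)) * √(vwt G x v₀) * √(treeSum G x) := by
  have h : vwt G x v₀ ^ (-avwt G a v₀ / 2) =
      vwt G x v₀ ^ (-(avwt G a v₀ + 1) / 2) * √(vwt G x v₀) := by
    rw [Real.sqrt_eq_rpow, ← Real.rpow_add (vwt_pos G hG hx v₀)]
    congr 1
    ring
  rw [Phi, h, ← Finset.mul_prod_erase Finset.univ _ (Finset.mem_univ v₀)]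
  ring

lemma Phi_pos [Nontrivial V] (hG : G.Connected) (a : Sym2 V → ℝ) (v₀ : V) {x : G.edgeSet → ℝ}
    (hx : ∀ e, 0 < x e) : 0 < Phi G a v₀ x := by
  rw [Phi_eq G hG a v₀ hx]
  have h1 := Real.sqrt_pos.2 (treeSum_pos G hG hx)
  have h2 := Real.sqrt_pos.2 (vwt_pos G hG hx v₀)
  have h3 : 0 < ∏ e : G.edgeSet, x e ^ a (e : Sym2 V) :=
    Finset.prod_pos fun e _ => Real.rpow_pos_of_pos (hx e) _
  have h4 : 0 < ∏ v, vwt G x v ^ (-(avwt G a v + 1) / 2) :=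
    Finset.prod_pos fun v _ => Real.rpow_pos_of_pos (vwt_pos G hG hx v) _
  positivity

lemma sum_avwt (a : Sym2 V → ℝ) : ∑ v, avwt G a v = 2 * ∑ e : G.edgeSet, a e := by
  simp only [avwt]
  rw [Finset.sum_comm, Finset.mul_sum]
  refine Finset.sum_congr rfl fun e _ => ?_
  rw [← Finset.sum_filter, Finset.sum_const]
  have : (Finset.univ.filter fun v => v ∈ (e : Sym2 V)) = (e : Sym2 V).toFinset := by
    ext v
    simp
  rw [this, Sym2.card_toFinset_of_not_isDiag _ (G.not_isDiag_of_mem_edgeSet e.2)]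
  simp

lemma vwt_smul (c : ℝ) (x : G.edgeSet → ℝ) (v : V) : vwt G (c • x) v = c * vwt G x v := by
  simp [vwt, Finset.mul_sum]

lemma treeSum_smul (c : ℝ) (x : G.edgeSet → ℝ) :
    treeSum G (c • x) = c ^ (Fintype.card V - 1) * treeSum G x := by
  simp only [treeSum, Finset.mul_sum]
  refine Finset.sum_congr rfl fun T _ => ?_
  split_ifs with hT
  · have := IsSpanningTree.card G hT
    rw [← this]
    simp [Finset.prod_mul_distrib]
  · simp

/-- `Phi` is homogeneous of degree zero. -/
lemma Phi_smul [Nontrivial V] (hG : G.Connected) (a : Sym2 V → ℝ) (v₀ : V) {x : G.edgeSet → ℝ}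
    (hx : ∀ e, 0 < x e) {c : ℝ} (hc : 0 < c) : Phi G a v₀ (c • x) = Phi G a v₀ x := by
  have hcx : ∀ e, 0 < (c • x) e := fun e => mul_pos hc (hx e)
  rw [Phi_eq G hG a v₀ hcx, Phi_eq G hG a v₀ hx]
  have h1 : ∏ e : G.edgeSet, (c • x) e ^ a (e : Sym2 V) =
      c ^ (∑ e : G.edgeSet, a e) * ∏ e : G.edgeSet, x e ^ a (e : Sym2 V) := by
    rw [Real.rpow_sum_of_pos hc, ← Finset.prod_mul_distrib]
    exact Finset.prod_congr rfl fun e _ => Real.mul_rpow hc.le (hx e).le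
  have h2 : ∏ v, vwt G (c • x) v ^ (-(avwt G a v + 1) / 2) =
      c ^ (∑ v, -(avwt G a v + 1) / 2) * ∏ v, vwt G x v ^ (-(avwt G a v + 1) / 2) := by
    rw [Real.rpow_sum_of_pos hc, ← Finset.prod_mul_distrib]
    refine Finset.prod_congr rfl fun v _ => ?_
    rw [vwt_smul, Real.mul_rpow hc.le (vwt_pos G hG hx v).le]
  have h3 : ∑ v, -(avwt G a v + 1) / 2 =
      -(∑ e : G.edgeSet, a e) - (Fintype.card V : ℝ) / 2 := by
    rw [← Finset.sum_div, Finset.sum_neg_distrib, Finset.sum_add_distrib, sum_avwt]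
    simp
    ring
  have h4 : √(c ^ (Fintype.card V - 1)) = c ^ (((Fintype.card V : ℝ) - 1) / 2) := by
    rw [Real.sqrt_eq_rpow, ← Real.rpow_natCast, ← Real.rpow_mul hc.le,
      Nat.cast_sub Fintype.card_pos]
    congr 1
    push_cast
    ring
  rw [h1, h2, h3, vwt_smul, treeSum_smul, Real.sqrt_mul hc.le, Real.sqrt_mul (by positivity), h4,
    Real.sqrt_eq_rpow c]
  have h5 : c ^ (∑ e : G.edgeSet, a e) * c ^ (-(∑ e : G.edgeSet, a e) - (Fintype.card V : ℝ) / 2) *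
      c ^ (1 / 2 : ℝ) * c ^ (((Fintype.card V : ℝ) - 1) / 2) = 1 := by
    rw [← Real.rpow_add hc, ← Real.rpow_add hc, ← Real.rpow_add hc, ← Real.rpow_zero c]
    congr 1
    ring
  linear_combination ((∏ e : G.edgeSet, x e ^ a (e : Sym2 V)) *
    (∏ v, vwt G x v ^ (-(avwt G a v + 1) / 2)) * √(vwt G x v₀) * √(treeSum G x)) * h5

lemma maxsq_nonneg (φ : Sym2 V → ℝ) (v : V) : 0 ≤ maxsq G φ v :=
  Real.sSup_nonneg (by rintro _ ⟨p, -, rfl⟩; positivity)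

lemma sq_sub_le_maxsq (φ : Sym2 V → ℝ) {v : V} {e e' : G.edgeSet} (he : v ∈ (e : Sym2 V))
    (he' : v ∈ (e' : Sym2 V)) : (φ e - φ e') ^ 2 ≤ maxsq G φ v :=
  le_csSup (Set.toFinite _).bddAbove ⟨(e, e'), ⟨he, he'⟩, rfl⟩

lemma Sphi_nonneg {a : Sym2 V → ℝ} (ha : ∀ e ∈ G.edgeSet, 0 < a e) (φ : Sym2 V → ℝ) :
    0 ≤ Sphi G a φ :=
  Finset.sum_nonneg fun v _ =>
    mul_nonneg (by linarith [avwt_nonneg G ha v]) (maxsq_nonneg G φ v)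

lemma Xi_pos (φ : Sym2 V → ℝ) (γ : ℝ) {x : G.edgeSet → ℝ} (hx : ∀ e, 0 < x e) (e : G.edgeSet) :
    0 < Xi G φ γ x e :=
  mul_pos (Real.exp_pos _) (hx e)

lemma vwt_Xi_neg_mul_vwt_Xi_le (φ : Sym2 V → ℝ) (γ : ℝ) {x : G.edgeSet → ℝ} (hx : ∀ e, 0 < x e)
    (v : V) : vwt G (Xi G φ (-γ) x) v * vwt G (Xi G φ γ x) v ≤
      Real.exp (γ ^ 2 * maxsq G φ v / 2) * (vwt G x v * vwt G x v) := by
  have key : ∀ e e' : G.edgeSet,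
      ((if v ∈ (e : Sym2 V) then Xi G φ (-γ) x e else 0) *
        (if v ∈ (e' : Sym2 V) then Xi G φ γ x e' else 0) +
      (if v ∈ (e' : Sym2 V) then Xi G φ (-γ) x e' else 0) *
        (if v ∈ (e : Sym2 V) then Xi G φ γ x e else 0)) ≤
      2 * (Real.exp (γ ^ 2 * maxsq G φ v / 2) * ((if v ∈ (e : Sym2 V) then x e else 0) *
        (if v ∈ (e' : Sym2 V) then x e' else 0))) := by
    intro e e'
    by_cases he : v ∈ (e : Sym2 V)
    · by_cases he' : v ∈ (e' : Sym2 V)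
      · simp only [he, he', if_true, Xi]
        have h1 : Real.cosh (γ * (φ e - φ e')) ≤ Real.exp (γ ^ 2 * maxsq G φ v / 2) := by
          refine (Real.cosh_le_exp_half_sq _).trans (Real.exp_le_exp.2 ?_)
          have := mul_le_mul_of_nonneg_left (sq_sub_le_maxsq G φ he he') (sq_nonneg γ)
          rw [mul_pow]
          linarith
        have h2 : Real.exp (-γ * φ e) * x e * (Real.exp (γ * φ e') * x e') +
            Real.exp (-γ * φ e') * x e' * (Real.exp (γ * φ e) * x e) =
            2 * (Real.cosh (γ * (φ e - φ e')) * (x e * x e')) := by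
          have h3 : Real.exp (γ * (φ e - φ e')) = Real.exp (-γ * φ e') * Real.exp (γ * φ e) := by
            rw [← Real.exp_add]
            congr 1
            ring
          have h4 : Real.exp (-(γ * (φ e - φ e'))) = Real.exp (-γ * φ e) * Real.exp (γ * φ e') := by
            rw [← Real.exp_add]
            congr 1
            ring
          rw [Real.cosh_eq, h3, h4]
          ring
        rw [h2]
        have := mul_pos (hx e) (hx e')
        gcongr
      · simp [he']
    · simp [he]
  have h := Finset.sum_le_sum fun e (_ : e ∈ Finset.univ) =>
    Finset.sum_le_sum fun e' (_ : e' ∈ Finset.univ) => key e e'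
  simp only [Finset.sum_add_distrib, ← Finset.mul_sum, ← Finset.sum_mul] at h
  simp only [vwt]
  linarith

lemma treeSum_sq_le (φ : Sym2 V → ℝ) (γ : ℝ) {x : G.edgeSet → ℝ} (hx : ∀ e, 0 < x e) :
    treeSum G x ^ 2 ≤ treeSum G (Xi G φ (-γ) x) * treeSum G (Xi G φ γ x) := by
  have hnn : ∀ (y : G.edgeSet → ℝ), (∀ e, 0 < y e) → ∀ T ∈ (Finset.univ : Finset (Finset G.edgeSet)),
      0 ≤ if IsSpanningTree G T then ∏ e ∈ T, y e else 0 := by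
    intro y hy T _
    split_ifs
    exacts [Finset.prod_nonneg fun e _ => (hy e).le, le_rfl]
  refine Finset.sum_sq_le_sum_mul_sum_of_sq_le_mul _ (hnn _ (Xi_pos G φ _ hx))
    (hnn _ (Xi_pos G φ _ hx)) fun T _ => le_of_eq ?_
  split_ifs
  · rw [← Finset.prod_pow, ← Finset.prod_mul_distrib]
    refine Finset.prod_congr rfl fun e _ => ?_
    have : Real.exp (-γ * φ e) * Real.exp (γ * φ e) = 1 := by
      rw [← Real.exp_add]
      simp
    simp only [Xi]
    linear_combination (-(x e) ^ 2) * this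
  · simp

lemma vwt_Xi_eq {φ : Sym2 V → ℝ} {v : V} {t : ℝ}
    (hφ : ∀ e : G.edgeSet, v ∈ (e : Sym2 V) → φ e = t) (γ : ℝ) (x : G.edgeSet → ℝ) :
    vwt G (Xi G φ γ x) v = Real.exp (γ * t) * vwt G x v := by
  simp only [vwt, Finset.mul_sum]
  refine Finset.sum_congr rfl fun e _ => ?_
  split_ifs with h
  · simp [Xi, hφ e h]
  · simp

lemma prod_vwt_Xi_ge [Nontrivial V] (hG : G.Connected) {a : Sym2 V → ℝ}
    (ha : ∀ e ∈ G.edgeSet, 0 < a e) (φ : Sym2 V → ℝ) (γ : ℝ) {x : G.edgeSet → ℝ}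
    (hx : ∀ e, 0 < x e) :
    Real.exp (-(γ ^ 2 * Sphi G a φ / 2)) *
      ((∏ v, vwt G x v ^ (-(avwt G a v + 1) / 2)) *
        ∏ v, vwt G x v ^ (-(avwt G a v + 1) / 2)) ≤
      (∏ v, vwt G (Xi G φ (-γ) x) v ^ (-(avwt G a v + 1) / 2)) *
        ∏ v, vwt G (Xi G φ γ x) v ^ (-(avwt G a v + 1) / 2) := by
  have h : Real.exp (-(γ ^ 2 * Sphi G a φ / 2)) =
      ∏ v, Real.exp (γ ^ 2 * maxsq G φ v / 2) ^ (-(avwt G a v + 1) / 2) := by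
    simp only [← Real.exp_mul]
    rw [← Real.exp_sum]
    congr 1
    rw [Sphi, Finset.mul_sum, Finset.sum_div, ← Finset.sum_neg_distrib]
    exact Finset.sum_congr rfl fun v _ => by ring
  rw [h, ← Finset.prod_mul_distrib, ← Finset.prod_mul_distrib, ← Finset.prod_mul_distrib]
  refine Finset.prod_le_prod (fun v _ => ?_) fun v _ => ?_
  · have := vwt_pos G hG hx v
    positivity
  · have h0 := vwt_pos G hG hx v
    have h1 := vwt_pos G hG (Xi_pos G φ (-γ) hx) v
    have h2 := vwt_pos G hG (Xi_pos G φ γ hx) v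
    rw [← Real.mul_rpow h0.le h0.le, ← Real.mul_rpow (by positivity) (by positivity),
      ← Real.mul_rpow h1.le h2.le]
    exact Real.rpow_le_rpow_of_nonpos (mul_pos h1 h2) (vwt_Xi_neg_mul_vwt_Xi_le G φ γ hx v)
      (by linarith [avwt_nonneg G ha v])

/-- Deforming the two densities in opposite directions increases their product. -/
lemma exp_mul_Phi_mul_Phi_le [Nontrivial V] (hG : G.Connected) {a φ : Sym2 V → ℝ}
    (ha : ∀ e ∈ G.edgeSet, 0 < a e) {v₀ v₁ : V}
    (h₀ : ∀ e : G.edgeSet, v₀ ∈ (e : Sym2 V) → φ e = 0)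
    (h₁ : ∀ e : G.edgeSet, v₁ ∈ (e : Sym2 V) → φ e = 1) (γ : ℝ)
    {x : G.edgeSet → ℝ} (hx : ∀ e, 0 < x e) :
    Real.exp (γ / 2 - γ ^ 2 * Sphi G a φ / 2) * (Phi G a v₀ x * Phi G a v₁ x) ≤
      Phi G a v₀ (Xi G φ (-γ) x) * Phi G a v₁ (Xi G φ γ x) := by
  rw [Phi_eq G hG a v₀ hx, Phi_eq G hG a v₁ hx, Phi_eq G hG a v₀ (Xi_pos G φ (-γ) hx),
    Phi_eq G hG a v₁ (Xi_pos G φ γ hx), vwt_Xi_eq G h₀, vwt_Xi_eq G h₁]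
  have hA : (∏ e : G.edgeSet, Xi G φ (-γ) x e ^ a (e : Sym2 V)) *
      (∏ e : G.edgeSet, Xi G φ γ x e ^ a (e : Sym2 V)) =
      (∏ e : G.edgeSet, x e ^ a (e : Sym2 V)) * ∏ e : G.edgeSet, x e ^ a (e : Sym2 V) := by
    rw [← Finset.prod_mul_distrib, ← Finset.prod_mul_distrib]
    refine Finset.prod_congr rfl fun e _ => ?_
    rw [← Real.mul_rpow (Xi_pos G φ _ hx e).le (Xi_pos G φ _ hx e).le,
      ← Real.mul_rpow (hx e).le (hx e).le]
    congr 1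
    have : Real.exp (-γ * φ e) * Real.exp (γ * φ e) = 1 := by
      rw [← Real.exp_add]
      simp
    simp only [Xi]
    linear_combination ((x e) ^ 2) * this
  have hB := prod_vwt_Xi_ge G hG ha φ γ hx
  have hT : √(treeSum G x) * √(treeSum G x) ≤
      √(treeSum G (Xi G φ (-γ) x)) * √(treeSum G (Xi G φ γ x)) := by
    rw [Real.mul_self_sqrt (treeSum_pos G hG hx).le,
      ← Real.sqrt_mul (treeSum_pos G hG (Xi_pos G φ (-γ) hx)).le]
    exact Real.le_sqrt_of_sq_le (treeSum_sq_le G φ γ hx)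
  have hE : √(Real.exp (γ * 1)) = Real.exp (γ / 2) := by
    rw [mul_one, Real.sqrt_eq_rpow, ← Real.exp_mul]
    congr 1
    ring
  have hA0 : 0 < ∏ e : G.edgeSet, x e ^ a (e : Sym2 V) :=
    Finset.prod_pos fun e _ => Real.rpow_pos_of_pos (hx e) _
  have hB0 : 0 < ∏ v, vwt G x v ^ (-(avwt G a v + 1) / 2) :=
    Finset.prod_pos fun v _ => Real.rpow_pos_of_pos (vwt_pos G hG hx v) _
  rw [mul_zero, Real.exp_zero, one_mul, Real.sqrt_mul (Real.exp_pos _).le, hE, sub_eq_add_neg,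
    Real.exp_add]
  generalize (∏ e : G.edgeSet, x e ^ a (e : Sym2 V)) = A at *
  generalize (∏ v, vwt G x v ^ (-(avwt G a v + 1) / 2)) = B at *
  generalize (∏ e : G.edgeSet, Xi G φ (-γ) x e ^ a (e : Sym2 V)) = A₁ at *
  generalize (∏ e : G.edgeSet, Xi G φ γ x e ^ a (e : Sym2 V)) = A₂ at *
  generalize (∏ v, vwt G (Xi G φ (-γ) x) v ^ (-(avwt G a v + 1) / 2)) = B₁ at *
  generalize (∏ v, vwt G (Xi G φ γ x) v ^ (-(avwt G a v + 1) / 2)) = B₂ at *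
  have hs : 0 ≤ Real.exp (γ / 2) * √(vwt G x v₀) * √(vwt G x v₁) := by positivity
  calc _ = (A * A) * (Real.exp (γ / 2) * √(vwt G x v₀) * √(vwt G x v₁)) *
        ((Real.exp (-(γ ^ 2 * Sphi G a φ / 2)) * (B * B)) *
          (√(treeSum G x) * √(treeSum G x))) := by ring
    _ ≤ (A * A) * (Real.exp (γ / 2) * √(vwt G x v₀) * √(vwt G x v₁)) *
        ((B₁ * B₂) * (√(treeSum G (Xi G φ (-γ) x)) * √(treeSum G (Xi G φ γ x)))) := by
      gcongr ?_ * ?_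
      exact mul_le_mul hB hT (by positivity) (le_trans (by positivity) hB)
    _ = _ := by
      rw [← hA]
      ring

lemma rpow_vwt_ratio_mul_Phi_sq [Nontrivial V] (hG : G.Connected) (a : Sym2 V → ℝ) (v₀ v₁ : V)
    {x : G.edgeSet → ℝ} (hx : ∀ e, 0 < x e) :
    ((vwt G x v₁ / vwt G x v₀) ^ ((1 : ℝ) / 4) * Phi G a v₀ x) ^ 2 =
      Phi G a v₀ x * Phi G a v₁ x := by
  have p0 := vwt_pos G hG hx v₀
  have p1 := vwt_pos G hG hx v₁
  have h : ((vwt G x v₁ / vwt G x v₀) ^ ((1 : ℝ) / 4)) ^ 2 * √(vwt G x v₀) = √(vwt G x v₁) := by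
    rw [← Real.rpow_natCast, ← Real.rpow_mul (by positivity), Real.sqrt_eq_rpow,
      Real.sqrt_eq_rpow, Real.div_rpow p1.le p0.le]
    have := Real.rpow_pos_of_pos p0 (1 / 2)
    norm_num
    field_simp
  rw [Phi_eq G hG a v₀ hx, Phi_eq G hG a v₁ hx, ← h]
  ring

end Algebra

section Symmetry

variable {V : Type*} [Fintype V] [DecidableEq V] {G : SimpleGraph V} [Fintype G.edgeSet]

lemma mem_mapEdgeSet_iff (F : G ≃g G) (e : G.edgeSet) (v : V) :
    F v ∈ (F.mapEdgeSet e : Sym2 V) ↔ v ∈ (e : Sym2 V) := by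
  change F v ∈ Sym2.map F e ↔ _
  rw [Sym2.mem_map]
  exact ⟨fun ⟨w, hw, h⟩ => F.injective h ▸ hw, fun h => ⟨v, h, rfl⟩⟩

lemma vwt_comp (F : G ≃g G) (x : G.edgeSet → ℝ) (v : V) :
    vwt G (x ∘ F.mapEdgeSet) v = vwt G x (F v) := by
  simp only [vwt]
  rw [← Equiv.sum_comp F.mapEdgeSet fun e : G.edgeSet => if F v ∈ (e : Sym2 V) then x e else 0]
  simp only [mem_mapEdgeSet_iff, Function.comp_apply]

lemma avwt_comp (F : G ≃g G) {a : Sym2 V → ℝ}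
    (ha : ∀ e : G.edgeSet, a (F.mapEdgeSet e) = a e) (v : V) :
    avwt G a (F v) = avwt G a v := by
  simp only [avwt]
  rw [← Equiv.sum_comp F.mapEdgeSet]
  simp only [mem_mapEdgeSet_iff, ha]

lemma isSpanningTree_map (F : G ≃g G) (T : Finset G.edgeSet) :
    IsSpanningTree G (T.map F.mapEdgeSet.toEmbedding) ↔ IsSpanningTree G T := by
  refine (SimpleGraph.Iso.isTree_iff ⟨F.toEquiv, fun {u v} => ?_⟩).symm
  simp only [SimpleGraph.fromEdgeSet_adj, Finset.coe_map, Equiv.coe_toEmbedding]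
  refine and_congr ⟨?_, ?_⟩ F.injective.ne_iff
  · rintro ⟨_, ⟨e, he, rfl⟩, h⟩
    refine ⟨e, he, Sym2.map.injective F.injective ?_⟩
    exact h
  · rintro ⟨e, he, h⟩
    refine ⟨_, ⟨e, he, rfl⟩, ?_⟩
    change Sym2.map F e = _
    rw [h]
    rfl

lemma treeSum_comp (F : G ≃g G) (x : G.edgeSet → ℝ) :
    treeSum G (x ∘ F.mapEdgeSet) = treeSum G x := by
  simp only [treeSum]
  rw [← Equiv.sum_comp F.mapEdgeSet.finsetCongr fun T : Finset G.edgeSet =>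
    if IsSpanningTree G T then ∏ e ∈ T, x e else 0]
  simp only [Equiv.finsetCongr_apply, isSpanningTree_map, Finset.prod_map,
    Equiv.coe_toEmbedding, Function.comp_apply]

lemma Phi_comp [Nontrivial V] (hG : G.Connected) (F : G ≃g G) {a : Sym2 V → ℝ}
    (ha : ∀ e : G.edgeSet, a (F.mapEdgeSet e) = a e) (v : V) {x : G.edgeSet → ℝ}
    (hx : ∀ e, 0 < x e) : Phi G a v (x ∘ F.mapEdgeSet) = Phi G a (F v) x := by
  have hx' : ∀ e, 0 < (x ∘ F.mapEdgeSet) e := fun e => hx (F.mapEdgeSet e)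
  rw [Phi_eq G hG a v hx', Phi_eq G hG a (F v) hx, treeSum_comp, vwt_comp,
    ← Equiv.prod_comp F.mapEdgeSet fun e : G.edgeSet => x e ^ a (e : Sym2 V),
    ← Equiv.prod_comp F.toEquiv fun v => vwt G x v ^ (-(avwt G a v + 1) / 2)]
  simp only [Function.comp_apply, ha, vwt_comp, RelIso.coe_fn_toEquiv, avwt_comp F ha]

end Symmetry

section LogCoordinates

lemma logMeasure_eq_map_exp : logMeasure = Measure.map Real.exp volume := by
  ext s hs
  rw [Measure.map_apply Real.measurable_exp hs, logMeasure, withDensity_apply _ hs,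
    Measure.restrict_restrict hs]
  have himg : s ∩ Set.Ioi 0 = Real.exp '' (Real.exp ⁻¹' s) := by
    rw [Set.image_preimage_eq_inter_range, Real.range_exp]
  rw [himg, lintegral_image_eq_lintegral_abs_deriv_mul (Real.measurable_exp hs)
    (fun x _ => (Real.hasDerivAt_exp x).hasDerivWithinAt) Real.exp_injective.injOn]
  have : ∀ x : ℝ, ENNReal.ofReal |Real.exp x| * ENNReal.ofReal (1 / Real.exp x) = 1 := by
    intro x
    rw [← ENNReal.ofReal_mul (abs_nonneg _), abs_of_pos (Real.exp_pos x),
      mul_one_div_cancel (Real.exp_pos x).ne', ENNReal.ofReal_one]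
  simp only [this, lintegral_one, Measure.restrict_apply_univ]

instance : SigmaFinite logMeasure := by
  rw [logMeasure]
  exact SigmaFinite.withDensity_ofReal _

variable {V : Type*} [Fintype V] [DecidableEq V] (G : SimpleGraph V) [Fintype G.edgeSet]

/-- Logarithmic coordinates on `Omega G e₀`. -/
noncomputable def expCoord (e₀ : G.edgeSet) (y : {e : G.edgeSet // e ≠ e₀} → ℝ) : G.edgeSet → ℝ :=
  fun e => if h : e = e₀ then 1 else Real.exp (y ⟨e, h⟩)

/-- Extension by zero of a function defined away from `e₀`. -/
noncomputable def extendZero (e₀ : G.edgeSet) :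
    ({e : G.edgeSet // e ≠ e₀} → ℝ) →ₗ[ℝ] (G.edgeSet → ℝ) where
  toFun y e := if h : e = e₀ then 0 else y ⟨e, h⟩
  map_add' y y' := by
    ext e
    by_cases h : e = e₀ <;> simp [h]
  map_smul' c y := by
    ext e
    by_cases h : e = e₀ <;> simp [h]

lemma extendZero_self (e₀ : G.edgeSet) (y : {e : G.edgeSet // e ≠ e₀} → ℝ) :
    extendZero G e₀ y e₀ = 0 := by
  simp [extendZero]

lemma extendZero_of_ne {e₀ : G.edgeSet} (y : {e : G.edgeSet // e ≠ e₀} → ℝ)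
    (e : {e : G.edgeSet // e ≠ e₀}) : extendZero G e₀ y e = y e := by
  simp [extendZero, e.2]

lemma expCoord_eq (e₀ : G.edgeSet) (y : {e : G.edgeSet // e ≠ e₀} → ℝ) (e : G.edgeSet) :
    expCoord G e₀ y e = Real.exp (extendZero G e₀ y e) := by
  by_cases h : e = e₀ <;> simp [expCoord, extendZero, h]

lemma expCoord_pos (e₀ : G.edgeSet) (y : {e : G.edgeSet // e ≠ e₀} → ℝ) (e : G.edgeSet) :
    0 < expCoord G e₀ y e := by
  rw [expCoord_eq]
  exact Real.exp_pos _

lemma measurable_expCoord (e₀ : G.edgeSet) : Measurable (expCoord G e₀) := by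
  refine measurable_pi_iff.2 fun e => ?_
  by_cases h : e = e₀
  · simp only [expCoord, h, dite_true]
    exact measurable_const
  · simp only [expCoord, h, dite_false]
    fun_prop

lemma rho_eq_map (e₀ : G.edgeSet) : rho G e₀ = Measure.map (expCoord G e₀) volume := by
  have hsf : ∀ e : G.edgeSet,
      SigmaFinite (if e = e₀ then Measure.dirac (1 : ℝ) else logMeasure) := by
    intro e
    split_ifs <;> infer_instance
  refine Measure.pi_eq fun s hs => ?_
  rw [Measure.map_apply (measurable_expCoord G e₀) (MeasurableSet.univ_pi hs)]
  have hne : ∀ e : {e : G.edgeSet // e ≠ e₀},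
      (if (e : G.edgeSet) = e₀ then Measure.dirac (1 : ℝ) else logMeasure) (s e) =
        volume (Real.exp ⁻¹' s e) := by
    intro e
    rw [if_neg e.2, logMeasure_eq_map_exp, Measure.map_apply Real.measurable_exp (hs e)]
  rw [← Fintype.prod_subtype_mul_prod_subtype (fun e : G.edgeSet => e ≠ e₀),
    Finset.prod_congr rfl fun e _ => hne e, ← volume_pi_pi]
  have huniq : ∏ e : {e : G.edgeSet // ¬ e ≠ e₀},
      (if (e : G.edgeSet) = e₀ then Measure.dirac (1 : ℝ) else logMeasure) (s e) =
        (Measure.dirac (1 : ℝ)) (s e₀) := by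
    rw [Fintype.prod_eq_single ⟨e₀, by simp⟩ fun e he => (he (Subtype.ext (not_not.1 e.2))).elim]
    simp
  rw [huniq, Measure.dirac_apply' _ (hs e₀)]
  by_cases h1 : (1 : ℝ) ∈ s e₀
  · rw [Set.indicator_of_mem h1, Pi.one_apply, mul_one]
    congr 1
    ext y
    simp only [Set.mem_preimage, Set.mem_univ_pi]
    refine ⟨fun h e => ?_, fun h e => ?_⟩
    · simpa [expCoord, e.2] using h e
    · by_cases he : e = e₀
      · subst he
        simpa [expCoord] using h1
      · simpa [expCoord, he] using h ⟨e, he⟩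
  · rw [Set.indicator_of_notMem h1, mul_zero]
    convert measure_empty (μ := volume)
    refine Set.eq_empty_of_forall_notMem fun y hy => h1 ?_
    simpa [expCoord] using Set.mem_univ_pi.1 hy e₀

lemma lintegral_rho (e₀ : G.edgeSet) {F : (G.edgeSet → ℝ) → ℝ≥0∞} (hF : Measurable F) :
    ∫⁻ x, F x ∂rho G e₀ = ∫⁻ y, F (expCoord G e₀ y) := by
  rw [rho_eq_map, lintegral_map hF (measurable_expCoord G e₀)]

lemma ae_rho_pos (e₀ : G.edgeSet) : ∀ᵐ x ∂rho G e₀, ∀ e, 0 < x e := by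
  rw [rho_eq_map, ae_map_iff (measurable_expCoord G e₀).aemeasurable
    (by
      simp only [Set.ofPred_forall]
      exact MeasurableSet.iInter fun e =>
        measurableSet_lt measurable_const (measurable_pi_apply e))]
  exact Filter.Eventually.of_forall fun y => expCoord_pos G e₀ y

lemma measurable_vwt (v : V) : Measurable fun x => vwt G x v :=
  Finset.measurable_sum _ fun e _ => by
    split_ifs
    exacts [measurable_pi_apply e, measurable_const]

lemma measurable_Phi (a : Sym2 V → ℝ) (v₀ : V) : Measurable (Phi G a v₀) := by
  have h1 : Measurable (treeSum G) := Finset.measurable_sum _ fun T _ => by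
    split_ifs
    exacts [Finset.measurable_prod _ fun e _ => measurable_pi_apply e, measurable_const]
  refine ((Measurable.mul ?_ ?_).mul ?_).mul h1.sqrt
  · exact Finset.measurable_prod _ fun e _ => (measurable_pi_apply e).pow_const _
  · exact (measurable_vwt G v₀).pow_const _
  · exact Finset.measurable_prod _ fun v _ => (measurable_vwt G v).pow_const _

lemma measurable_Xi (φ : Sym2 V → ℝ) (γ : ℝ) : Measurable (Xi G φ γ) :=
  measurable_pi_iff.2 fun e => (measurable_pi_apply e).const_mul _

lemma lintegral_rho_Xi {e₀ : G.edgeSet} {φ : Sym2 V → ℝ} (hφ : φ e₀ = 0) (γ : ℝ)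
    {F : (G.edgeSet → ℝ) → ℝ≥0∞} (hF : Measurable F) :
    ∫⁻ x, F (Xi G φ γ x) ∂rho G e₀ = ∫⁻ x, F x ∂rho G e₀ := by
  have hFX : Measurable fun x => F (Xi G φ γ x) := hF.comp (measurable_Xi G φ γ)
  rw [lintegral_rho G e₀ hFX, lintegral_rho G e₀ hF,
    ← lintegral_add_right_eq_self (fun y => F (expCoord G e₀ y))
      fun e : {e : G.edgeSet // e ≠ e₀} => γ * φ (e : G.edgeSet)]
  refine lintegral_congr fun y => congrArg F ?_
  ext e
  by_cases h : e = e₀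
  · subst h
    simp [Xi, expCoord, hφ]
  · simp [Xi, expCoord, h, Real.exp_add, mul_comm]

/-- The action of a permutation of the edges in logarithmic coordinates. -/
noncomputable def permLog (e₀ : G.edgeSet) (σ : Equiv.Perm G.edgeSet) :
    ({e : G.edgeSet // e ≠ e₀} → ℝ) →ₗ[ℝ] ({e : G.edgeSet // e ≠ e₀} → ℝ) where
  toFun y e := extendZero G e₀ y (σ e) - extendZero G e₀ y (σ e₀)
  map_add' y y' := by
    ext e
    simp only [map_add, Pi.add_apply]
    ring
  map_smul' c y := by
    ext e
    simp only [map_smul, Pi.smul_apply, smul_eq_mul, RingHom.id_apply]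
    ring

lemma extendZero_permLog (e₀ : G.edgeSet) (σ : Equiv.Perm G.edgeSet)
    (y : {e : G.edgeSet // e ≠ e₀} → ℝ) (e : G.edgeSet) :
    extendZero G e₀ (permLog G e₀ σ y) e =
      extendZero G e₀ y (σ e) - extendZero G e₀ y (σ e₀) := by
  by_cases h : e = e₀
  · subst h
    rw [extendZero_self, sub_self]
  · exact extendZero_of_ne G _ ⟨e, h⟩

lemma det_permLog_ne_zero (e₀ : G.edgeSet) (σ : Equiv.Perm G.edgeSet) :
    LinearMap.det (permLog G e₀ σ) ≠ 0 := by
  intro h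
  refine (LinearMap.bot_lt_ker_of_det_eq_zero h).ne' (LinearMap.ker_eq_bot'.2 fun y hy => ?_)
  have key : ∀ e, extendZero G e₀ y (σ e) = extendZero G e₀ y (σ e₀) := by
    intro e
    have := extendZero_permLog G e₀ σ y e
    rw [hy, map_zero, Pi.zero_apply] at this
    linarith
  ext e
  rw [← extendZero_of_ne G y e, Pi.zero_apply, ← extendZero_self G e₀ y,
    ← σ.apply_symm_apply (e : G.edgeSet), key, ← key (σ.symm e₀), σ.apply_symm_apply]

lemma expCoord_permLog (e₀ : G.edgeSet) (σ : Equiv.Perm G.edgeSet)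
    (y : {e : G.edgeSet // e ≠ e₀} → ℝ) :
    expCoord G e₀ (permLog G e₀ σ y) =
      (expCoord G e₀ y (σ e₀))⁻¹ • (expCoord G e₀ y ∘ σ) := by
  ext e
  simp only [expCoord_eq, extendZero_permLog, Real.exp_sub, Pi.smul_apply, Function.comp_apply,
    smul_eq_mul]
  rw [div_eq_inv_mul]

lemma Phi_expCoord_permLog [Nontrivial V] (hG : G.Connected) (e₀ : G.edgeSet) (F : G ≃g G)
    {a : Sym2 V → ℝ} (ha : ∀ e : G.edgeSet, a (F.mapEdgeSet e) = a e) (v : V)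
    (y : {e : G.edgeSet // e ≠ e₀} → ℝ) :
    Phi G a v (expCoord G e₀ (permLog G e₀ F.mapEdgeSet y)) =
      Phi G a (F v) (expCoord G e₀ y) := by
  have hpos : ∀ e, 0 < (expCoord G e₀ y ∘ F.mapEdgeSet) e := fun e => expCoord_pos G e₀ y _
  rw [expCoord_permLog, Phi_smul G hG a v hpos
    (inv_pos.2 (expCoord_pos G e₀ y _)), Phi_comp hG F ha v (expCoord_pos G e₀ y)]

lemma z_automorphism [Nontrivial V] (hG : G.Connected) (e₀ : G.edgeSet) (F : G ≃g G)
    {a : Sym2 V → ℝ} (ha : ∀ e : G.edgeSet, a (F.mapEdgeSet e) = a e) (v : V) :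
    z G a (F v) e₀ =
      ENNReal.ofReal |(LinearMap.det (permLog G e₀ F.mapEdgeSet))⁻¹| * z G a v e₀ := by
  have hm := fun v => (measurable_Phi G a v).ennreal_ofReal
  have hm' : Measurable fun y => ENNReal.ofReal (Phi G a v (expCoord G e₀ y)) :=
    (hm v).comp (measurable_expCoord G e₀)
  simp only [z]
  rw [lintegral_rho G e₀ (hm _), lintegral_rho G e₀ (hm _), ← smul_eq_mul,
    ← lintegral_smul_measure,
    ← Measure.map_linearMap_addHaar_eq_smul_addHaar volume (det_permLog_ne_zero G e₀ F.mapEdgeSet),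
    lintegral_map hm' (LinearMap.continuous_of_finiteDimensional _).measurable]
  exact lintegral_congr fun y => by
    rw [Phi_expCoord_permLog G hG e₀ F ha v y]

lemma z_ne_zero [Nontrivial V] (hG : G.Connected) (a : Sym2 V → ℝ) (v : V) (e₀ : G.edgeSet) :
    z G a v e₀ ≠ 0 := by
  have hm := (measurable_Phi G a v).ennreal_ofReal
  have hm' : Measurable fun y => ENNReal.ofReal (Phi G a v (expCoord G e₀ y)) :=
    hm.comp (measurable_expCoord G e₀)
  rw [z, lintegral_rho G e₀ hm, ← pos_iff_ne_zero, lintegral_pos_iff_support hm']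
  have : (Function.support fun y => ENNReal.ofReal (Phi G a v (expCoord G e₀ y))) = Set.univ :=
    Set.eq_univ_of_forall fun y =>
      (ENNReal.ofReal_pos.2 (Phi_pos G hG a v (expCoord_pos G e₀ y))).ne'
  rw [this]
  exact Measure.measure_univ_pos.2 (NeZero.ne _)

/-- An automorphism exchanging two vertices makes their normalizing constants equal. -/
lemma z_eq_of_swap [Nontrivial V] (hG : G.Connected) (e₀ : G.edgeSet) (F : G ≃g G)
    {a : Sym2 V → ℝ} (ha : ∀ e : G.edgeSet, a (F.mapEdgeSet e) = a e) {v₀ v₁ : V}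
    (h₀ : F v₀ = v₁) (h₁ : F v₁ = v₀) (hz : z G a v₀ e₀ ≠ ⊤) : z G a v₁ e₀ = z G a v₀ e₀ := by
  have e1 := z_automorphism G hG e₀ F ha v₀
  have e2 := z_automorphism G hG e₀ F ha v₁
  rw [h₀] at e1
  rw [h₁, e1, ← mul_assoc] at e2
  have hc := (ENNReal.mul_eq_right (z_ne_zero G hG a v₀ e₀) hz).1 e2.symm
  have : ENNReal.ofReal |(LinearMap.det (permLog G e₀ F.mapEdgeSet))⁻¹| = 1 := by
    rw [← ENNReal.ofReal_mul (abs_nonneg _), ENNReal.ofReal_eq_one, ← sq] at hc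
    rw [(pow_eq_one_iff_of_nonneg (abs_nonneg _) two_ne_zero).1 hc, ENNReal.ofReal_one]
  rw [e1, this, one_mul]

lemma lintegral_rpow_vwt_ratio_mul_Phi_le [Nontrivial V] (hG : G.Connected) {a φ : Sym2 V → ℝ}
    (ha : ∀ e ∈ G.edgeSet, 0 < a e) {v₀ v₁ : V} {e₀ : G.edgeSet} (he₀ : v₀ ∈ (e₀ : Sym2 V))
    (h₀ : ∀ e : G.edgeSet, v₀ ∈ (e : Sym2 V) → φ e = 0)
    (h₁ : ∀ e : G.edgeSet, v₁ ∈ (e : Sym2 V) → φ e = 1) (γ : ℝ) :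
    ∫⁻ x, ENNReal.ofReal ((vwt G x v₁ / vwt G x v₀) ^ ((1 : ℝ) / 4) * Phi G a v₀ x) ∂rho G e₀ ≤
      ENNReal.ofReal (Real.exp (-(γ / 4 - γ ^ 2 * Sphi G a φ / 4))) *
        (z G a v₀ e₀ ^ (1 / 2 : ℝ) * z G a v₁ e₀ ^ (1 / 2 : ℝ)) := by
  have hm := fun v => (measurable_Phi G a v).ennreal_ofReal
  have hm0 := (hm v₀).comp (measurable_Xi G φ (-γ))
  have hm1 := (hm v₁).comp (measurable_Xi G φ γ)
  calc _ ≤ ∫⁻ x, ENNReal.ofReal (Real.exp (-(γ / 4 - γ ^ 2 * Sphi G a φ / 4))) *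
        (ENNReal.ofReal (Phi G a v₀ (Xi G φ (-γ) x)) ^ (1 / 2 : ℝ) *
          ENNReal.ofReal (Phi G a v₁ (Xi G φ γ x)) ^ (1 / 2 : ℝ)) ∂rho G e₀ := by
        refine lintegral_mono_ae ?_
        filter_upwards [ae_rho_pos G e₀] with x hx
        have p0 := Phi_pos G hG a v₀ (Xi_pos G φ (-γ) hx)
        have p1 := Phi_pos G hG a v₁ (Xi_pos G φ γ hx)
        rw [ENNReal.ofReal_rpow_of_pos p0, ENNReal.ofReal_rpow_of_pos p1,
          ← ENNReal.ofReal_mul (by positivity), ← ENNReal.ofReal_mul (by positivity)]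
        refine ENNReal.ofReal_le_ofReal (le_of_sq_le_sq ?_ (by positivity))
        rw [rpow_vwt_ratio_mul_Phi_sq G hG a v₀ v₁ hx, mul_pow, mul_pow, ← Real.sqrt_eq_rpow,
          ← Real.sqrt_eq_rpow, Real.sq_sqrt p0.le, Real.sq_sqrt p1.le, ← Real.exp_nat_mul]
        have hle := mul_le_mul_of_nonneg_left (exp_mul_Phi_mul_Phi_le G hG ha h₀ h₁ γ hx)
          (Real.exp_pos (-(γ / 2 - γ ^ 2 * Sphi G a φ / 2))).le
        rw [← mul_assoc, ← Real.exp_add, neg_add_cancel, Real.exp_zero, one_mul] at hle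
        convert hle using 3
        push_cast
        ring
    _ = ENNReal.ofReal (Real.exp (-(γ / 4 - γ ^ 2 * Sphi G a φ / 4))) *
        ∫⁻ x, ENNReal.ofReal (Phi G a v₀ (Xi G φ (-γ) x)) ^ (1 / 2 : ℝ) *
          ENNReal.ofReal (Phi G a v₁ (Xi G φ γ x)) ^ (1 / 2 : ℝ) ∂rho G e₀ :=
      lintegral_const_mul _ ((hm0.pow_const _).mul (hm1.pow_const _))
    _ ≤ _ := by
      gcongr
      refine (ENNReal.lintegral_mul_norm_pow_le hm0.aemeasurable hm1.aemeasurable (by norm_num)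
        (by norm_num) (by norm_num)).trans_eq ?_
      simp only [Function.comp_apply]
      rw [lintegral_rho_Xi G (h₀ e₀ he₀) _ (hm v₀), lintegral_rho_Xi G (h₀ e₀ he₀) _ (hm v₁)]
      rfl

end LogCoordinates

end ERRWGraph

open ERRWGraph in
/-- Lemma 2.5 (Main lemma, abstract version): under Assumption 2.3,
`E_{ℚ_{v₀,e₀}}[(x_{v₁}/x_{v₀})^{1/4}] ≤ exp(-1/(32 S_φ))`. -/
theorem main_lemma_abstract {V : Type*} [Fintype V] [DecidableEq V]
    (G : SimpleGraph V) [Fintype G.edgeSet] (hG : G.Connected)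
    (a φ : Sym2 V → ℝ) (ha : ∀ e ∈ G.edgeSet, 0 < a e)
    (v₀ v₁ : V) (e₀ : G.edgeSet)
    (hass : Assumption23 G a φ v₀ v₁ e₀)
    (hz0 : z G a v₀ e₀ ≠ ⊤) (hz1 : z G a v₁ e₀ ≠ ⊤) :
    (∫⁻ x, ENNReal.ofReal ((vwt G x v₁ / vwt G x v₀) ^ ((1 : ℝ) / 4)) ∂Qm G a v₀ e₀)
      ≤ ENNReal.ofReal (Real.exp (-(1 / (32 * Sphi G a φ)))) := by
  obtain ⟨hne, -, he₀, ⟨f, ⟨hbij, hadj, haf⟩, hf₀, hf₁⟩, -, h₀, h₁⟩ := hass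
  have : Nontrivial V := ⟨v₀, v₁, hne⟩
  let F : G ≃g G := ⟨Equiv.ofBijective f hbij, fun {u v} => hadj u v⟩
  have hF : ∀ e : G.edgeSet, a (F.mapEdgeSet e) = a e := by
    rintro ⟨e, he⟩
    induction e using Sym2.ind with
    | _ u v => exact haf u v he
  have hz : z G a v₁ e₀ = z G a v₀ e₀ := z_eq_of_swap G hG e₀ F hF hf₀ hf₁ hz0
  have hS := Sphi_nonneg G ha φ
  have hint := lintegral_rpow_vwt_ratio_mul_Phi_le G hG ha he₀ h₀ h₁ (1 / (2 * Sphi G a φ))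
  rw [hz, ← ENNReal.rpow_add_of_nonneg _ _ (by norm_num) (by norm_num), add_halves,
    ENNReal.rpow_one] at hint
  have hmeas : Measurable fun x : G.edgeSet → ℝ =>
      ENNReal.ofReal ((vwt G x v₁ / vwt G x v₀) ^ ((1 : ℝ) / 4)) :=
    (((measurable_vwt G v₁).div (measurable_vwt G v₀)).pow_const _).ennreal_ofReal
  rw [Qm, lintegral_smul_measure, lintegral_withDensity_eq_lintegral_mul _
    (measurable_Phi G a v₀).ennreal_ofReal hmeas, smul_eq_mul]
  have hcongr : ∫⁻ x, ((fun x => ENNReal.ofReal (Phi G a v₀ x)) * fun x : G.edgeSet → ℝ =>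
      ENNReal.ofReal ((vwt G x v₁ / vwt G x v₀) ^ ((1 : ℝ) / 4))) x ∂rho G e₀ =
      ∫⁻ x, ENNReal.ofReal ((vwt G x v₁ / vwt G x v₀) ^ ((1 : ℝ) / 4) * Phi G a v₀ x)
        ∂rho G e₀ := by
    refine lintegral_congr_ae ?_
    filter_upwards [ae_rho_pos G e₀] with x hx
    rw [Pi.mul_apply, ← ENNReal.ofReal_mul (Phi_pos G hG a v₀ hx).le, mul_comm]
  rw [hcongr]
  refine (mul_le_mul_right hint _).trans ?_
  rw [mul_left_comm, ENNReal.inv_mul_cancel (z_ne_zero G hG a v₀ e₀) hz0, mul_one]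
  refine ENNReal.ofReal_le_ofReal (Real.exp_le_exp.2 (neg_le_neg ?_))
  rcases hS.eq_or_lt with h | h
  · simp [← h]
  · have : 1 / (2 * Sphi G a φ) / 4 - (1 / (2 * Sphi G a φ)) ^ 2 * Sphi G a φ / 4 =
        2 * (1 / (32 * Sphi G a φ)) := by
      field_simp
      norm_num
    rw [this]
    have : 0 < 1 / (32 * Sphi G a φ) := by positivity
    linarith
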